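/- The integral over the real line ∫_{-∞}^{∞} log y · log(1 − 2 y (y + i)) · log(log y) / (y² + 1) dy equals (1/2) · i · π² · log 5 · log(iπ/2), where log denotes the principal branch of the complex logarithm. -/

import Mathlib

open Complex MeasureTheory Real

section Aux

open Filter Topology Set

noncomputable def FF (z : ℂ) : ℂ :=
  Complex.log z * Complex.log (1 - 2 * z * (z + I)) * Complex.log (Complex.log z)

lemma q_slit {z : ℂ} (hz : 0 ≤ z.im) : 1 - 2 * z * (z + I) ∈ slitPlane := by
  rw [mem_slitPlane_iff]
  by_cases h : z.re = 0
  · left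
    simp [h]
    nlinarith
  · right
    simp
    intro h2
    have : z.re * (2 * z.im + 1) = 0 := by linarith
    rcases mul_eq_zero.1 this with h3 | h3
    · exact h h3
    · linarith

lemma log_im_pos {z : ℂ} (hz : 0 < z.im) : 0 < (Complex.log z).im := by
  rw [Complex.log_im]
  refine lt_of_le_of_ne (Complex.arg_nonneg_iff.2 hz.le) (fun h => ?_)
  have := (Complex.arg_eq_zero_iff.1 h.symm).2
  linarith

lemma FF_diff {z : ℂ} (hz : 0 < z.im) : DifferentiableAt ℂ FF z := by
  have h1 : z ∈ slitPlane := by rw [mem_slitPlane_iff]; right; exact hz.ne'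
  have h2 : Complex.log z ∈ slitPlane := by
    rw [mem_slitPlane_iff]; right; exact (log_im_pos hz).ne'
  have h3 := q_slit hz.le
  unfold FF
  have d1 : DifferentiableAt ℂ Complex.log z := differentiableAt_id.clog h1
  have d2 : DifferentiableAt ℂ (fun z : ℂ => 1 - 2 * z * (z + I)) z := by fun_prop
  exact (d1.mul (d2.clog h3)).mul (d1.clog h2)

lemma log_cwa {w : ℂ} (hw : w ≠ 0)  :
    ContinuousWithinAt Complex.log {z : ℂ | 0 ≤ z.im} w := by
  by_cases h : w ∈ slitPlane
  · exact (continuousAt_clog h).continuousWithinAt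
  · rw [mem_slitPlane_iff] at h
    push Not at h
    apply Complex.continuousWithinAt_log_of_re_neg_of_im_zero _ h.2
    refine lt_of_le_of_ne h.1 (fun h' => hw (Complex.ext h' h.2))

lemma FF_cwa {y : ℝ} (h0 : y ≠ 0) (h1 : y ≠ 1) (h2 : y ≠ -1) :
    ContinuousWithinAt FF {z : ℂ | 0 ≤ z.im} (y : ℂ) := by
  have hl : ContinuousWithinAt Complex.log {z : ℂ | 0 ≤ z.im} (y : ℂ) :=
    log_cwa (by exact_mod_cast h0)
  have hq : ContinuousWithinAt (fun z : ℂ => Complex.log (1 - 2 * z * (z + I)))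
      {z : ℂ | 0 ≤ z.im} (y : ℂ) := by
    apply ContinuousAt.continuousWithinAt
    have hc : ContinuousAt (fun z : ℂ => 1 - 2 * z * (z + I)) (y : ℂ) := by fun_prop
    exact hc.clog (q_slit (z := (y : ℂ)) (by simp))
  have hy : Complex.log (y : ℂ) ≠ 0 := by
    intro h
    have h3 := congrArg Complex.re h
    rw [Complex.log_re, Complex.norm_real, Real.norm_eq_abs, Real.log_abs] at h3
    rcases Real.log_eq_zero.1 h3 with h | h | h <;> contradiction
  have hmap : ∀ z : ℂ, 0 ≤ z.im → 0 ≤ (Complex.log z).im := by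
    intro z hz; rw [Complex.log_im]; exact Complex.arg_nonneg_iff.2 hz
  have hll : ContinuousWithinAt (fun z : ℂ => Complex.log (Complex.log z))
      {z : ℂ | 0 ≤ z.im} (y : ℂ) :=
    (log_cwa hy).comp hl (fun z hz => hmap z hz)
  exact (hl.mul hq).mul hll

lemma clog_bound (w : ℂ) : ‖Complex.log w‖ ≤ |Real.log ‖w‖| + 4 := by
  have := Complex.norm_le_abs_re_add_abs_im (Complex.log w)
  rw [Complex.log_re, Complex.log_im] at this
  linarith [Complex.abs_arg_le_pi w, Real.pi_lt_four]

lemma q_bound {z : ℂ} (hz : 0 < z.im) :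
    |Real.log ‖1 - 2 * z * (z + I)‖| ≤ 4 + 2 * |Real.log ‖z‖| := by
  have hz0 : z ≠ 0 := by rintro rfl; simp at hz
  have hn : 0 < ‖z‖ := norm_pos_iff.2 hz0
  set t := |Real.log ‖z‖| with ht
  have hzt : ‖z‖ ≤ Real.exp t := by
    rw [← Real.log_le_iff_le_exp hn]; exact le_abs_self _
  have het : 1 ≤ Real.exp t := Real.one_le_exp (abs_nonneg _)
  have hup : ‖1 - 2 * z * (z + I)‖ ≤ 1 + 2 * ‖z‖ * (‖z‖ + 1) := by
    calc _ ≤ ‖(1:ℂ)‖ + ‖2 * z * (z + I)‖ := norm_sub_le _ _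
      _ ≤ _ := by
        rw [norm_mul, norm_mul]
        have := norm_add_le z I
        simp at this ⊢
        gcongr
  have hlow : 1 / 2 ≤ ‖1 - 2 * z * (z + I)‖ := by
    have e : 1 - 2 * z * (z + I) = (-2) * ((z - (-I + 1) / 2) * (z - (-I - 1) / 2)) := by
      ring_nf; simp; ring
    have a : 1 / 2 ≤ ‖z - (-I + 1) / 2‖ := by
      refine le_trans ?_ ((le_abs_self _).trans (Complex.abs_im_le_norm _))
      simp; linarith
    have b : 1 / 2 ≤ ‖z - (-I - 1) / 2‖ := by
      refine le_trans ?_ ((le_abs_self _).trans (Complex.abs_im_le_norm _))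
      simp; linarith
    rw [e, norm_mul, norm_mul]
    simp only [norm_neg, Complex.norm_ofNat]
    nlinarith
  have e4 : (5:ℝ) ≤ Real.exp 4 := by
    have := Real.add_one_le_exp (4:ℝ); linarith
  have hpos : 0 < ‖1 - 2 * z * (z + I)‖ := by linarith
  rw [abs_le]
  constructor
  · have : Real.log (1/2) ≤ Real.log ‖1 - 2 * z * (z + I)‖ := Real.log_le_log (by norm_num) hlow
    have h2 : Real.log (1/2) = - Real.log 2 := by rw [one_div, Real.log_inv]
    have : Real.log 2 ≤ 1 := by linarith [Real.log_two_lt_d9]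
    have : 0 ≤ t := abs_nonneg _
    linarith
  · rw [Real.log_le_iff_le_exp hpos, Real.exp_add, two_mul t, Real.exp_add]
    calc _ ≤ 1 + 2 * ‖z‖ * (‖z‖ + 1) := hup
      _ ≤ 1 + 2 * Real.exp t * (Real.exp t + 1) := by gcongr
      _ ≤ 5 * (Real.exp t * Real.exp t) := by nlinarith
      _ ≤ _ := by gcongr

lemma xlogx_bound {L : ℝ} (hL : 0 ≤ L) : L * |Real.log L| ≤ 1 + L ^ 2 := by
  rcases hL.eq_or_lt with rfl | h
  · simp
  rcases le_total L 1 with h1 | h1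
  · have := Real.abs_log_mul_self_lt L h h1
    rw [abs_mul, abs_of_pos h] at this
    nlinarith
  · rw [abs_of_nonneg (Real.log_nonneg h1)]
    have := Real.log_le_sub_one_of_pos h
    nlinarith

lemma FF_bound : ∃ K : ℝ, 0 < K ∧ ∀ z : ℂ, 0 < z.im →
    ‖FF z‖ ≤ K * (√‖z‖ + (√‖z‖)⁻¹) := by
  refine ⟨10000000, by norm_num, fun z hz => ?_⟩
  have hz0 : z ≠ 0 := by rintro rfl; simp at hz
  have hn : 0 < ‖z‖ := norm_pos_iff.2 hz0
  have hL := clog_bound z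
  have hQ := (clog_bound (1 - 2 * z * (z + I))).trans (add_le_add_left (q_bound hz) 4)
  have hLL := clog_bound (Complex.log z)
  have hx := xlogx_bound (norm_nonneg (Complex.log z))
  set t := |Real.log ‖z‖| with ht
  have ht0 : 0 ≤ t := abs_nonneg _
  set L := ‖Complex.log z‖ with hLdef
  have hL0 : 0 ≤ L := norm_nonneg _
  have h1 : L * ‖Complex.log (Complex.log z)‖ ≤ 33 * (1 + t) ^ 2 := by
    calc _ ≤ L * (|Real.log L| + 4) := by gcongr
      _ ≤ 1 + L ^ 2 + 4 * L := by linarith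
      _ ≤ 1 + (t + 4) ^ 2 + 4 * (t + 4) := by gcongr
      _ ≤ _ := by nlinarith
  have h2 : ‖FF z‖ ≤ 33 * (1 + t) ^ 2 * (8 * (1 + t)) := by
    unfold FF
    rw [norm_mul, norm_mul, mul_right_comm]
    gcongr
    linarith
  have h3 : 1 + t ≤ 6 * Real.exp (t / 6) := by
    have := Real.add_one_le_exp (t / 6); linarith
  have h4 : (1 + t) ^ 3 ≤ 216 * Real.exp (t / 2) := by
    calc (1 + t) ^ 3 ≤ (6 * Real.exp (t / 6)) ^ 3 := by gcongr
      _ = 216 * Real.exp (t / 2) := by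
        rw [mul_pow, ← Real.exp_nat_mul]; norm_num; ring_nf
  have hs : Real.exp (Real.log ‖z‖ / 2) = √‖z‖ := by
    rw [Real.exp_half, Real.exp_log hn]
  have h5 : Real.exp (t / 2) ≤ √‖z‖ + (√‖z‖)⁻¹ := by
    rw [← hs, ← Real.exp_neg]
    have p1 := Real.exp_pos (Real.log ‖z‖ / 2)
    have p2 := Real.exp_pos (-(Real.log ‖z‖ / 2))
    rcases abs_cases (Real.log ‖z‖) with ⟨h, _⟩ | ⟨h, _⟩
    · rw [ht, h]; linarith
    · rw [ht, h, neg_div]; linarith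
  have := Real.exp_pos (t / 2)
  nlinarith

noncomputable def WW (y : ℝ) : ℝ := (1 + √|y| + (√|y|)⁻¹) / (1 + y ^ 2)

lemma WW_meas : Measurable WW := by unfold WW; fun_prop

lemma WW_nonneg (y : ℝ) : 0 ≤ WW y := by unfold WW; positivity

lemma WW_int : Integrable WW := by
  have h1 : IntegrableOn WW (Ioc 0 1) := by
    have := (intervalIntegral.intervalIntegrable_rpow' (a := 0) (b := 1)
      (r := -(1/2)) (by norm_num)).const_mul 3
    rw [intervalIntegrable_iff_integrableOn_Ioc_of_le zero_le_one] at this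
    refine this.mono' WW_meas.aestronglyMeasurable ?_
    refine (ae_restrict_iff' measurableSet_Ioc).2 (ae_of_all _ fun y hy => ?_)
    rw [Real.norm_of_nonneg (WW_nonneg y), Real.rpow_neg hy.1.le, ← Real.sqrt_eq_rpow]
    unfold WW
    rw [abs_of_pos hy.1]
    have hs : 0 < √y := Real.sqrt_pos.2 hy.1
    have hs1 : √y ≤ 1 := Real.sqrt_le_one.2 hy.2
    have : 1 ≤ (√y)⁻¹ := (one_le_inv₀ hs).2 hs1
    apply (div_le_self (by positivity) (by nlinarith)).trans
    linarith
  have h2 : IntegrableOn WW (Ioi 1) := by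
    have := (integrableOn_Ioi_rpow_of_lt (a := -(3/2)) (c := 1) (by norm_num) one_pos).const_mul 3
    refine this.mono' WW_meas.aestronglyMeasurable ?_
    refine (ae_restrict_iff' measurableSet_Ioi).2 (ae_of_all _ fun y hy => ?_)
    have hy1 : 1 < y := hy
    have hy0 : 0 < y := by linarith
    have e : y ^ (-(3/2) : ℝ) = √y / y ^ 2 := by
      rw [Real.sqrt_eq_rpow, ← Real.rpow_natCast, ← Real.rpow_sub hy0]; norm_num
    rw [Real.norm_of_nonneg (WW_nonneg y), e]
    unfold WW
    rw [abs_of_pos hy0]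
    have hs1 : 1 ≤ √y := Real.one_le_sqrt.2 hy1.le
    have : (√y)⁻¹ ≤ 1 := inv_le_one_of_one_le₀ hs1
    rw [← mul_div_assoc]
    apply div_le_div₀ (by positivity) (by linarith) (by positivity) (by linarith)
  have h3 : IntegrableOn WW (Ioi 0) := by
    rw [← Ioc_union_Ioi_eq_Ioi zero_le_one]; exact h1.union h2
  have h4 : IntegrableOn WW (Iic 0) := by
    have e : WW = fun y => WW (-y) := by funext y; simp [WW]
    rw [e, ← Measure.map_neg_eq_self (volume : Measure ℝ)]
    let m : MeasurableEmbedding fun x : ℝ => -x := (Homeomorph.neg ℝ).measurableEmbedding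
    rw [m.integrableOn_map_iff]
    simp only [Function.comp_def, neg_neg, neg_preimage, neg_Iic, neg_zero]
    exact Iff.mpr integrableOn_Ici_iff_integrableOn_Ioi (by simpa only [neg_neg, ← e] using h3)
  rw [← integrableOn_univ, ← Iic_union_Ioi (a := (0:ℝ))]
  exact h4.union h3

lemma den_eq (y : ℝ) : ((y : ℂ) ^ 2 + 1) = (((1 + y ^ 2 : ℝ)) : ℂ) := by push_cast; ring

lemma den_norm (y : ℝ) : ‖((y : ℂ) ^ 2 + 1)‖ = 1 + y ^ 2 := by
  rw [den_eq, Complex.norm_real, Real.norm_of_nonneg (by positivity)]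

lemma half_plane (G : ℂ → ℂ) (A : ℝ) (hd : ∀ z : ℂ, 0 ≤ z.im → DifferentiableAt ℂ G z)
    (hb : ∀ z : ℂ, 0 ≤ z.im → ‖G z‖ ≤ A * (1 + √‖z‖)) :
    ∫ y : ℝ, G y / ((y : ℂ) ^ 2 + 1) = π * G I := by
  have hA : 0 ≤ A := by
    have := (norm_nonneg _).trans (hb 0 (by simp))
    simpa using this
  have hcG : Continuous (fun y : ℝ => G y) := by
    rw [continuous_iff_continuousAt]
    intro y
    exact ContinuousAt.comp (f := fun y : ℝ => (y : ℂ)) (hd y (by simp)).continuousAt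
      Complex.continuous_ofReal.continuousAt
  have hden : ∀ y : ℝ, ((y : ℂ) ^ 2 + 1) ≠ 0 := fun y => by
    rw [← norm_ne_zero_iff, den_norm]; positivity
  have hi1 : Integrable (fun y : ℝ => G y / ((y : ℂ) ^ 2 + 1)) := by
    refine (WW_int.const_mul A).mono'
      (Continuous.aestronglyMeasurable (hcG.div (by fun_prop) hden)) (ae_of_all _ fun y => ?_)
    rw [norm_div, den_norm]
    unfold WW
    rw [← mul_div_assoc]
    gcongr
    refine (hb y (by simp)).trans ?_
    rw [Complex.norm_real, Real.norm_eq_abs]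
    refine mul_le_mul_of_nonneg_left ?_ hA
    linarith [inv_nonneg.2 (Real.sqrt_nonneg |y|)]
  have e0 : ∀ y : ℝ, G I / ((y : ℂ) ^ 2 + 1) = G I * (((1 + y ^ 2)⁻¹ : ℝ) : ℂ) := by
    intro y; rw [den_eq, Complex.ofReal_inv]; rfl
  have hi2 : Integrable (fun y : ℝ => G I / ((y : ℂ) ^ 2 + 1)) := by
    simp_rw [e0]
    exact integrable_inv_one_add_sq.ofReal.const_mul _
  have hv2 : ∫ y : ℝ, G I / ((y : ℂ) ^ 2 + 1) = π * G I := by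
    simp_rw [e0]
    rw [integral_const_mul, integral_complex_ofReal, integral_univ_inv_one_add_sq, mul_comm]
  set g : ℂ → ℂ := fun z => dslope G I z / (z + I) with hg
  have hzI : ∀ z : ℂ, 0 ≤ z.im → z + I ≠ 0 := by
    intro z hz h
    have := congrArg Complex.im h
    simp at this; linarith
  have hgeq : ∀ z : ℂ, z ≠ I → g z = (G z - G I) / (z ^ 2 + 1) := by
    intro z hz
    simp only [hg]
    rw [dslope_of_ne _ hz, slope_def_field, div_div]
    congr 1
    ring_nf; simp; ring
  have hgr : ∀ y : ℝ, g y = G y / ((y : ℂ) ^ 2 + 1) - G I / ((y : ℂ) ^ 2 + 1) := by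
    intro y
    rw [hgeq, sub_div]
    intro h
    have := congrArg Complex.im h
    simp at this
  have hgi : Integrable (fun y : ℝ => g y) := by
    simp_rw [hgr]; exact hi1.sub hi2
  have hgc : ∀ z : ℂ, 0 ≤ z.im → ContinuousAt g z := by
    intro z hz
    refine ContinuousAt.div (f := dslope G I) (g := fun z => z + I) ?_ (by fun_prop) (hzI z hz)
    by_cases h : z = I
    · rw [h, continuousAt_dslope_same]; exact hd I (by simp)
    · rw [continuousAt_dslope_of_ne h]; exact (hd z hz).continuousAt
  have hgd : ∀ z : ℂ, 0 ≤ z.im → z ≠ I → DifferentiableAt ℂ g z := by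
    intro z hz h
    refine DifferentiableAt.fun_div (c := dslope G I) (d := fun z => z + I) ?_ (by fun_prop) (hzI z hz)
    rw [differentiableAt_dslope_of_ne h]; exact hd z hz
  have hgb : ∀ R : ℝ, 2 ≤ R → ∀ z : ℂ, 0 ≤ z.im → R ≤ ‖z‖ → ‖g z‖ ≤ 8 * A / (R * √R) := by
    intro R hR z hz hRz
    have hne : z ≠ I := by
      rintro rfl; simp at hRz; linarith
    have hs1 : 1 ≤ √‖z‖ := Real.one_le_sqrt.2 (by linarith)
    have hsq : √‖z‖ * √‖z‖ = ‖z‖ := Real.mul_self_sqrt (norm_nonneg _)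
    have hR0 : 0 < √R := Real.sqrt_pos.2 (by linarith)
    have hsR : √R ≤ √‖z‖ := Real.sqrt_le_sqrt hRz
    have n1 : ‖G z - G I‖ ≤ 4 * A * √‖z‖ := by
      have a := norm_sub_le (G z) (G I)
      have b := hb z hz
      have c := hb I (by simp)
      simp at c
      nlinarith
    have n2 : ‖z‖ ^ 2 / 2 ≤ ‖z ^ 2 + 1‖ := by
      have := norm_sub_norm_le (z ^ 2) (-1)
      simp at this
      nlinarith
    rw [hgeq z hne, norm_div]
    have hz0 : 0 < ‖z‖ := by linarith
    calc _ ≤ (4 * A * √‖z‖) / (‖z‖ ^ 2 / 2) := by gcongr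
      _ = 8 * A / (‖z‖ * √‖z‖) := by
        have : √‖z‖ ≠ 0 := by linarith
        rw [div_eq_div_iff (by positivity) (by positivity)]
        linear_combination 4 * A * ‖z‖ * hsq
      _ ≤ _ := by gcongr
  have hrect : ∀ R : ℝ, 2 ≤ R → ‖∫ x : ℝ in (-R)..R, g x‖ ≤ 32 * A / √R := by
    intro R hR
    have hR0 : 0 < R := by linarith
    have key := integral_boundary_rect_eq_zero_of_differentiable_on_off_countable g
      (⟨-R, 0⟩ : ℂ) (⟨R, R⟩ : ℂ) {I} (countable_singleton I) ?_ ?_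
    · simp only [Complex.ofReal_zero, zero_mul, add_zero] at key
      set a := ∫ x : ℝ in (-R)..R, g x
      have b2 : ‖∫ x : ℝ in (-R)..R, g (x + R * I)‖ ≤ 8 * A / (R * √R) * |R - (-R)| := by
        apply intervalIntegral.norm_integral_le_of_norm_le_const
        intro x hx
        apply hgb R hR _ (by simp; linarith)
        refine le_trans ?_ ((le_abs_self _).trans (Complex.abs_im_le_norm _))
        simp
      have b3 : ‖∫ y : ℝ in (0:ℝ)..R, g (R + y * I)‖ ≤ 8 * A / (R * √R) * |R - 0| := by
        apply intervalIntegral.norm_integral_le_of_norm_le_const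
        intro x hx
        rw [uIoc_of_le hR0.le] at hx
        apply hgb R hR _ (by simp; linarith [hx.1])
        refine le_trans ?_ ((le_abs_self _).trans (Complex.abs_re_le_norm _))
        simp
      have b4 : ‖∫ y : ℝ in (0:ℝ)..R, g ((-R : ℝ) + y * I)‖ ≤ 8 * A / (R * √R) * |R - 0| := by
        apply intervalIntegral.norm_integral_le_of_norm_le_const
        intro x hx
        rw [uIoc_of_le hR0.le] at hx
        apply hgb R hR _ (by simp; linarith [hx.1])
        refine le_trans ?_ ((neg_le_abs _).trans (Complex.abs_re_le_norm _))
        simp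
      rw [abs_of_pos (by linarith)] at b2 b3 b4
      have e : a = (∫ x : ℝ in (-R)..R, g (x + R * I)) - I • (∫ y : ℝ in (0:ℝ)..R, g (R + y * I))
          + I • (∫ y : ℝ in (0:ℝ)..R, g ((-R : ℝ) + y * I)) := by
        linear_combination key
      rw [e]
      refine (norm_add_le _ _).trans ?_
      refine (add_le_add_left (norm_sub_le _ _) _).trans ?_
      simp only [norm_smul, Complex.norm_I, one_mul]
      have hs : 0 < √R := Real.sqrt_pos.2 hR0
      have : 8 * A / (R * √R) * (R - (-R)) + 8 * A / (R * √R) * (R - 0)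
          + 8 * A / (R * √R) * (R - 0) = 32 * A / √R := by
        field_simp; ring
      linarith
    · intro z hz
      apply (hgc z _).continuousWithinAt
      have := hz.2
      simp [uIcc_of_le hR0.le] at this
      exact this.1
    · rintro z ⟨hz, hzn⟩
      apply hgd z _ hzn
      have := hz.2
      simp [hR0.le] at this
      exact this.1.le
  have hzero : ∫ x : ℝ, g x = 0 := by
    have t1 := intervalIntegral_tendsto_integral hgi tendsto_neg_atTop_atBot tendsto_id
    refine tendsto_nhds_unique t1 ?_
    apply squeeze_zero_norm' (a := fun R => 32 * A / √R)
    · filter_upwards [eventually_ge_atTop 2] with R hR using hrect R hR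
    · exact Real.tendsto_sqrt_atTop.const_div_atTop _
  simp_rw [hgr] at hzero
  rw [integral_sub hi1 hi2, hv2] at hzero
  exact sub_eq_zero.1 hzero

lemma sqrt_add_le_aux {a b : ℝ} (ha : 0 ≤ a) (hb : 0 ≤ b) : √(a + b) ≤ √a + √b := by
  rw [Real.sqrt_le_left (by positivity)]
  nlinarith [Real.sq_sqrt ha, Real.sq_sqrt hb, mul_nonneg (Real.sqrt_nonneg a) (Real.sqrt_nonneg b)]

lemma shifted {ε : ℝ} (hε : 0 < ε) :
    ∫ y : ℝ, FF (y + ε * I) / ((y : ℂ) ^ 2 + 1) = π * FF (I + ε * I) := by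
  obtain ⟨K, hK, hb⟩ := FF_bound
  refine half_plane (fun z => FF (z + ε * I)) (K * (1 + √ε + (√ε)⁻¹)) ?_ ?_
  · intro z hz
    have h : 0 < (z + ε * I).im := by simp; linarith
    exact (FF_diff h).comp z (f := fun z : ℂ => z + ε * I) (by fun_prop)
  · intro z hz
    have h : 0 < (z + ε * I).im := by simp; linarith
    refine (hb _ h).trans ?_
    rw [mul_assoc]
    refine mul_le_mul_of_nonneg_left ?_ hK.le
    have hlow : ε ≤ ‖z + ε * I‖ := by
      refine le_trans ?_ ((le_abs_self _).trans (Complex.abs_im_le_norm _))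
      simp; linarith
    have hup : ‖z + ε * I‖ ≤ ‖z‖ + ε := by
      refine (norm_add_le _ _).trans ?_
      simp [abs_of_pos hε]
    have hs : 0 < √ε := Real.sqrt_pos.2 hε
    have h1 : (√‖z + ε * I‖)⁻¹ ≤ (√ε)⁻¹ := by gcongr
    have h2 : √‖z + ε * I‖ ≤ √‖z‖ + √ε :=
      (Real.sqrt_le_sqrt hup).trans (sqrt_add_le_aux (by positivity) (by positivity))
    have h3 := Real.sqrt_nonneg ‖z‖
    have h4 : 0 < (√ε)⁻¹ := inv_pos.2 hs
    nlinarith [mul_nonneg hs.le h3, mul_nonneg h4.le h3]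

lemma FF_integral : ∫ y : ℝ, FF y / ((y : ℂ) ^ 2 + 1) = π * FF I := by
  obtain ⟨K, hK, hb⟩ := FF_bound
  have hpath : ∀ w : ℂ, Tendsto (fun ε : ℝ => w + ε * I) (𝓝[>] 0) (𝓝 w) := by
    intro w
    have : Continuous (fun ε : ℝ => w + ε * I) := by fun_prop
    have h := this.tendsto 0
    simp only [Complex.ofReal_zero, zero_mul, add_zero] at h
    exact h.mono_left nhdsWithin_le_nhds
  have t1 : Tendsto (fun ε : ℝ => ∫ y : ℝ, FF (y + ε * I) / ((y : ℂ) ^ 2 + 1)) (𝓝[>] 0)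
      (𝓝 (∫ y : ℝ, FF y / ((y : ℂ) ^ 2 + 1))) := by
    apply tendsto_integral_filter_of_dominated_convergence (fun y => K * WW y)
    · filter_upwards [self_mem_nhdsWithin] with ε hε
      have hε : 0 < ε := hε
      apply Continuous.aestronglyMeasurable
      refine Continuous.div ?_ (by fun_prop) (fun y => ?_)
      · rw [continuous_iff_continuousAt]
        intro y
        have h : 0 < ((y : ℂ) + ε * I).im := by simp [hε]
        exact ContinuousAt.comp (f := fun y : ℝ => (y : ℂ) + ε * I)
          (FF_diff h).continuousAt (by fun_prop)
      · rw [← norm_ne_zero_iff, den_norm]; positivity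
    · filter_upwards [Ioo_mem_nhdsGT (zero_lt_one' ℝ)] with ε hε
      have hne : ∀ᵐ y : ℝ, y ≠ 0 := Measure.ae_ne volume 0
      filter_upwards [hne] with y hy
      have h : 0 < ((y : ℂ) + ε * I).im := by simp [hε.1]
      rw [norm_div, den_norm]
      unfold WW
      rw [← mul_div_assoc]
      gcongr
      refine (hb _ h).trans ?_
      refine mul_le_mul_of_nonneg_left ?_ hK.le
      have hlow : |y| ≤ ‖(y : ℂ) + ε * I‖ := by
        have := Complex.abs_re_le_norm ((y : ℂ) + ε * I)
        simpa using this
      have hup : ‖(y : ℂ) + ε * I‖ ≤ 1 + |y| := by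
        refine (norm_add_le _ _).trans ?_
        simp [abs_of_pos hε.1]
        linarith [hε.2]
      have hs : 0 < √|y| := Real.sqrt_pos.2 (abs_pos.2 hy)
      have h1 : (√‖(y : ℂ) + ε * I‖)⁻¹ ≤ (√|y|)⁻¹ := by gcongr
      have h2 : √‖(y : ℂ) + ε * I‖ ≤ √1 + √|y| :=
        (Real.sqrt_le_sqrt hup).trans (sqrt_add_le_aux (by positivity) (by positivity))
      rw [Real.sqrt_one] at h2
      linarith
    · exact WW_int.const_mul K
    · filter_upwards [Measure.ae_ne volume (0:ℝ), Measure.ae_ne volume (1:ℝ),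
        Measure.ae_ne volume (-1:ℝ)] with y h0 h1 h2
      apply Tendsto.div_const
      refine (FF_cwa h0 h1 h2).tendsto.comp (tendsto_nhdsWithin_iff.2 ⟨hpath y, ?_⟩)
      filter_upwards [self_mem_nhdsWithin] with ε hε
      have hε : 0 < ε := hε
      simp [hε.le]
  have t2 : Tendsto (fun ε : ℝ => π * FF (I + ε * I)) (𝓝[>] 0) (𝓝 (π * FF I)) := by
    apply Tendsto.const_mul
    exact (FF_diff (z := I) (by simp)).continuousAt.tendsto.comp (hpath I)
  refine tendsto_nhds_unique t1 (t2.congr' ?_)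
  filter_upwards [self_mem_nhdsWithin] with ε hε using (shifted hε).symm

end Aux

theorem example_four :
    ∫ y : ℝ, Complex.log y * Complex.log (1 - 2 * (y : ℂ) * ((y : ℂ) + I)) *
        Complex.log (Complex.log y) / ((y : ℂ) ^ 2 + 1) =
      (1 / 2) * I * (π : ℂ) ^ 2 * Complex.log 5 * Complex.log (I * π / 2) := by
  have h := FF_integral
  unfold FF at h
  rw [h, Complex.log_I]
  have e : 1 - 2 * I * (I + I) = 5 := by
    linear_combination (-4) * Complex.I_mul_I
  have e2 : (π : ℂ) / 2 * I = I * π / 2 := by ring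
  rw [e, e2]
  ring
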